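/- For every real (or complex) x with 0 < |x| < π, coth⁴x = 1/x⁴ + 4/(3x²) + 26/45 + (2/π²) Σ_{n=1}^∞ (−1)^n (2n+1) [ (1/(6π²))(2n+2)(2n+3)ζ(2n+4) − (4/3)ζ(2n+2) ] (x/π)^{2n}, the series converging absolutely. -/

import Mathlib

open Real

/-- The value `ζ(2j + 2)` as a real series. -/
noncomputable def zetaEven (j : ℕ) : ℝ := ∑' k : ℕ, (((k : ℝ) + 1) ^ (2 * j + 2))⁻¹

lemma summable_inv_succ_pow (j : ℕ) :
    Summable fun k : ℕ => (((k : ℝ) + 1) ^ (2 * j + 2))⁻¹ := by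
  have h := (Real.summable_nat_pow_inv (p := 2 * j + 2)).2 (by omega)
  simpa using (summable_nat_add_iff 1).2 h

lemma zetaEven_nonneg (j : ℕ) : 0 ≤ zetaEven j := tsum_nonneg fun k => by positivity

lemma zetaEven_le (j : ℕ) : zetaEven j ≤ zetaEven 0 := by
  refine (summable_inv_succ_pow j).tsum_le_tsum (fun k => ?_) (summable_inv_succ_pow 0)
  gcongr
  · linarith [(Nat.cast_nonneg k : (0 : ℝ) ≤ k)]
  · omega

lemma riemannZeta_eq_zetaEven (j : ℕ) : riemannZeta (2 * (j : ℂ) + 2) = (zetaEven j : ℂ) := by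
  have h := zeta_nat_eq_tsum_of_gt_one (k := 2 * j + 2) (by omega)
  have hs : Summable fun n : ℕ => 1 / (n : ℂ) ^ (2 * j + 2) := by
    have hr := Real.summable_one_div_nat_pow.2 (by omega : 1 < 2 * j + 2)
    refine (Complex.ofRealCLM.summable hr).congr fun n => ?_
    simp
  rw [hs.tsum_eq_zero_add] at h
  push_cast at h
  rw [h, zetaEven, Complex.ofReal_tsum]
  simp

lemma zetaEven_zero : zetaEven 0 = π ^ 2 / 6 := by
  have h := riemannZeta_eq_zetaEven 0
  rw [show (2 * ((0 : ℕ) : ℂ) + 2) = 2 by simp, riemannZeta_two] at h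
  exact_mod_cast h.symm

lemma zetaEven_one : zetaEven 1 = π ^ 4 / 90 := by
  have h := riemannZeta_eq_zetaEven 1
  rw [show (2 * ((1 : ℕ) : ℂ) + 2) = 4 by norm_num, riemannZeta_four] at h
  exact_mod_cast h.symm

lemma pi_mul_coth_pi_mul {t : ℝ} (ht : t ≠ 0) :
    π * (cosh (π * t) / sinh (π * t)) =
      1 / t + ∑' k : ℕ, 2 * t / (t ^ 2 + ((k : ℝ) + 1) ^ 2) := by
  have hz : (t : ℂ) * Complex.I ∈ Complex.integerComplement := by
    rintro ⟨n, hn⟩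
    have := congrArg Complex.im hn
    simp at this
    exact ht this.symm
  have h := cot_series_rep' hz
  have hterm : ∀ n : ℕ, (1 / ((t : ℂ) * Complex.I - (n + 1)) + 1 / (t * Complex.I + (n + 1))) =
      -Complex.I * ((2 * t / (t ^ 2 + ((n : ℝ) + 1) ^ 2) : ℝ) : ℂ) := by
    intro n
    have h1 : (t : ℂ) ^ 2 + ((n : ℂ) + 1) ^ 2 ≠ 0 := by
      have : t ^ 2 + ((n : ℝ) + 1) ^ 2 ≠ 0 := by positivity
      exact_mod_cast this
    have h3 : ((t : ℂ) * Complex.I - (n + 1)) * (t * Complex.I + (n + 1)) =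
        -((t : ℂ) ^ 2 + ((n : ℂ) + 1) ^ 2) := by
      linear_combination (t : ℂ) ^ 2 * Complex.I_sq
    have h2 := mul_ne_zero_iff.1 (h3 ▸ neg_ne_zero.2 h1)
    rw [one_div_add_one_div h2.1 h2.2, h3]
    push_cast
    field_simp
    ring
  simp_rw [hterm] at h
  rw [tsum_mul_left, ← Complex.ofReal_tsum, ← mul_assoc, Complex.cot_eq_cos_div_sin,
    Complex.cos_mul_I, Complex.sin_mul_I] at h
  apply Complex.ofReal_injective
  have hs : Complex.sinh (π * t) ≠ 0 := by
    have : sinh (π * t) ≠ 0 := by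
      rw [Ne, Real.sinh_eq_zero]; positivity
    exact_mod_cast this
  have htc : (t : ℂ) ≠ 0 := by exact_mod_cast ht
  set S := ∑' k : ℕ, 2 * t / (t ^ 2 + ((k : ℝ) + 1) ^ 2)
  push_cast
  have e1 : (π : ℂ) * (Complex.cosh (π * t) / (Complex.sinh (π * t) * Complex.I)) =
      -Complex.I * (π * (Complex.cosh (π * t) / Complex.sinh (π * t))) := by
    rw [← div_div, Complex.div_I]; ring
  have e2 : 1 / ((t : ℂ) * Complex.I) = -Complex.I * (1 / t) := by
    rw [← div_div, Complex.div_I]; ring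
  rw [e1, e2, ← mul_sub] at h
  have := mul_left_cancel₀ (neg_ne_zero.2 Complex.I_ne_zero) h
  linear_combination this

/-- The coefficient of `t ^ (2j + 1)` in the expansion of `π coth (π t) - 1 / t`. -/
noncomputable def cothCoeff (j : ℕ) : ℝ := 2 * (-1) ^ j * zetaEven j

lemma abs_cothCoeff_le (j : ℕ) : |cothCoeff j| ≤ 2 * zetaEven 0 := by
  rw [cothCoeff, abs_mul, abs_mul, abs_pow, abs_of_nonneg (zetaEven_nonneg j)]
  simpa using zetaEven_le j

lemma tsum_partial_fractions {t : ℝ} (ht : |t| < 1) :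
    ∑' k : ℕ, 2 * t / (t ^ 2 + ((k : ℝ) + 1) ^ 2) = ∑' j : ℕ, cothCoeff j * t ^ (2 * j + 1) := by
  have ht2 : t ^ 2 < 1 := (sq_lt_one_iff_abs_lt_one t).2 ht
  have hrow : ∀ k : ℕ, HasSum
      (fun j : ℕ => 2 * (-1) ^ j * t ^ (2 * j + 1) * (((k : ℝ) + 1) ^ (2 * j + 2))⁻¹)
      (2 * t / (t ^ 2 + ((k : ℝ) + 1) ^ 2)) := by
    intro k
    have hk : (0 : ℝ) < (k : ℝ) + 1 := by positivity
    have hq : |-(t ^ 2 / ((k : ℝ) + 1) ^ 2)| < 1 := by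
      rw [abs_neg, abs_of_nonneg (by positivity), div_lt_one (by positivity)]
      nlinarith [(Nat.cast_nonneg k : (0 : ℝ) ≤ k)]
    have h := (hasSum_geometric_of_abs_lt_one hq).mul_left (2 * t / ((k : ℝ) + 1) ^ 2)
    convert! h using 1
    · ext j
      rw [neg_pow (t ^ 2 / _), div_pow, ← pow_mul, ← pow_mul, pow_add, pow_add]
      field_simp
    · have h0 : t ^ 2 + ((k : ℝ) + 1) ^ 2 ≠ 0 := by positivity
      have h1 : 1 - -(t ^ 2 / ((k : ℝ) + 1) ^ 2) =
          (t ^ 2 + ((k : ℝ) + 1) ^ 2) / ((k : ℝ) + 1) ^ 2 := by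
        field_simp
        ring
      rw [h1]
      field_simp
  have hsum : Summable (Function.uncurry fun k j : ℕ =>
      2 * (-1) ^ j * t ^ (2 * j + 1) * (((k : ℝ) + 1) ^ (2 * j + 2))⁻¹) := by
    have hg : Summable fun j : ℕ => 2 * (t ^ 2) ^ j :=
      (summable_geometric_of_lt_one (sq_nonneg t) ht2).mul_left 2
    have hp := (summable_inv_succ_pow 0).mul_of_nonneg hg
      (fun k => by positivity) (fun j => by positivity)
    refine Summable.of_norm_bounded hp ?_
    rintro ⟨k, j⟩
    have hk : (1 : ℝ) ≤ (k : ℝ) + 1 := by linarith [(Nat.cast_nonneg k : (0 : ℝ) ≤ k)]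
    have h1 : (((k : ℝ) + 1) ^ (2 * j + 2))⁻¹ ≤ (((k : ℝ) + 1) ^ (2 * 0 + 2))⁻¹ := by
      gcongr
      exact Nat.zero_le j
    have h2 : |t| ^ (2 * j + 1) ≤ (t ^ 2) ^ j := by
      rw [pow_succ, pow_mul, sq_abs]
      exact mul_le_of_le_one_right (by positivity) ht.le
    simp only [Function.uncurry, norm_mul, norm_pow, norm_neg, norm_one, one_pow, norm_inv,
      Real.norm_eq_abs, mul_one, abs_of_pos (by linarith : (0 : ℝ) < (k : ℝ) + 1)]
    rw [abs_of_pos (by norm_num : (0 : ℝ) < 2), mul_comm]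
    gcongr
  calc _ = ∑' (k : ℕ) (j : ℕ),
        2 * (-1) ^ j * t ^ (2 * j + 1) * (((k : ℝ) + 1) ^ (2 * j + 2))⁻¹ :=
        tsum_congr fun k => (hrow k).tsum_eq.symm
    _ = ∑' (j : ℕ) (k : ℕ),
        2 * (-1) ^ j * t ^ (2 * j + 1) * (((k : ℝ) + 1) ^ (2 * j + 2))⁻¹ := hsum.tsum_comm.symm
    _ = _ := tsum_congr fun j => by
        rw [tsum_mul_left, cothCoeff, zetaEven]
        ring

lemma summable_bound {r : ℝ} (hr0 : 0 < r) (hr : r < 1) (C : ℝ) :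
    Summable fun j : ℕ => C * (2 * (j : ℝ) + 1) ^ 3 * (r ^ (2 * j + 1) / r ^ 3) := by
  have h := summable_pow_mul_geometric_of_norm_lt_one 3 (r := r)
    (by rwa [Real.norm_eq_abs, abs_of_pos hr0])
  have hi : Function.Injective fun j : ℕ => 2 * j + 1 := fun a b hab => by simpa using hab
  refine ((h.comp_injective hi).mul_left (C / r ^ 3)).congr fun j => ?_
  simp only [Function.comp]
  push_cast
  ring

lemma norm_term_le {c : ℝ} {C : ℝ} {e j : ℕ} (hc : |c| ≤ C * (2 * (j : ℝ) + 1) ^ 3)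
    (he : 2 * j + 1 ≤ e + 3) {r y : ℝ} (hr0 : 0 < r) (hr : r < 1) (hy : |y| ≤ r) :
    ‖c * y ^ e‖ ≤ C * (2 * (j : ℝ) + 1) ^ 3 * (r ^ (2 * j + 1) / r ^ 3) := by
  rw [norm_mul, norm_pow, Real.norm_eq_abs, Real.norm_eq_abs]
  have h : |y| ^ e ≤ r ^ (2 * j + 1) / r ^ 3 := by
    rw [le_div_iff₀ (by positivity)]
    calc |y| ^ e * r ^ 3 ≤ r ^ e * r ^ 3 := by gcongr
      _ = r ^ (e + 3) := (pow_add r e 3).symm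
      _ ≤ r ^ (2 * j + 1) := pow_le_pow_of_le_one hr0.le hr.le he
  exact mul_le_mul hc h (by positivity) ((abs_nonneg c).trans hc)

lemma summable_term {c : ℕ → ℝ} {C : ℝ} {e : ℕ → ℕ}
    (hc : ∀ j, |c j| ≤ C * (2 * (j : ℝ) + 1) ^ 3)
    (he : ∀ j, 2 * j + 1 ≤ e j + 3) {y : ℝ} (hy : |y| < 1) :
    Summable fun j => c j * y ^ e j := by
  obtain ⟨r, hyr, hr⟩ := exists_between hy
  have hr0 : 0 < r := (abs_nonneg y).trans_lt hyr
  exact .of_norm_bounded (summable_bound hr0 hr C) fun j =>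
    norm_term_le (hc j) (he j) hr0 hr hyr.le

lemma hasDerivAt_tsum_term {c : ℕ → ℝ} {C : ℝ} {e : ℕ → ℕ}
    (hc : ∀ j, |c j * e j| ≤ C * (2 * (j : ℝ) + 1) ^ 3)
    (he : ∀ j, 2 * j + 1 ≤ e j + 2) {t : ℝ} (ht : |t| < 1) :
    HasDerivAt (fun y => ∑' j, c j * y ^ e j) (∑' j, c j * e j * t ^ (e j - 1)) t := by
  obtain ⟨r, htr, hr⟩ := exists_between ht
  have hr0 : 0 < r := (abs_nonneg t).trans_lt htr
  have hmem : ∀ y : ℝ, y ∈ Metric.ball (0 : ℝ) r ↔ |y| < r := fun y => by simp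
  refine hasDerivAt_tsum_of_isPreconnected (summable_bound hr0 hr C) Metric.isOpen_ball
    (convex_ball (0 : ℝ) r).isPreconnected (g := fun j y => c j * y ^ e j)
    (g' := fun j y => c j * e j * y ^ (e j - 1)) (fun j y _ => ?_)
    (fun j y hy => norm_term_le (hc j) (by have := he j; omega) hr0 hr ((hmem y).1 hy).le)
    (Metric.mem_ball_self hr0) ?_ ((hmem t).2 htr)
  · simpa [mul_assoc] using (hasDerivAt_pow (e j) y).const_mul (c j)
  · refine summable_of_ne_finset_zero (s := {0}) fun j hj => ?_
    have h0 : e j ≠ 0 := by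
      have := he j
      simp at hj
      omega
    simp [h0]

lemma abs_cothCoeff_mul_le {j : ℕ} {a : ℝ} (ha0 : 0 ≤ a) (ha : a ≤ (2 * (j : ℝ) + 1) ^ 3) :
    |cothCoeff j * a| ≤ 2 * zetaEven 0 * (2 * (j : ℝ) + 1) ^ 3 := by
  rw [abs_mul, abs_of_nonneg ha0]
  exact mul_le_mul (abs_cothCoeff_le j) ha ha0 ((abs_nonneg _).trans (abs_cothCoeff_le j))

lemma abs_cothCoeff_first_le (j : ℕ) :
    |cothCoeff j * (2 * j + 1 : ℕ)| ≤ 2 * zetaEven 0 * (2 * (j : ℝ) + 1) ^ 3 :=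
  abs_cothCoeff_mul_le (by positivity) (by
    push_cast
    exact le_self_pow₀ (by linarith [(Nat.cast_nonneg j : (0 : ℝ) ≤ j)]) (by norm_num))

lemma abs_cothCoeff_third_le (j : ℕ) :
    |cothCoeff j * (2 * j + 1 : ℕ) * (2 * j : ℕ) * (2 * j - 1 : ℕ)| ≤
      2 * zetaEven 0 * (2 * (j : ℝ) + 1) ^ 3 := by
  rw [mul_assoc, mul_assoc]
  refine abs_cothCoeff_mul_le (by positivity) ?_
  norm_cast
  calc (2 * j + 1) * (2 * j * (2 * j - 1)) ≤ (2 * j + 1) * ((2 * j + 1) * (2 * j + 1)) := by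
        gcongr <;> omega
    _ = (2 * j + 1) ^ 3 := by ring

lemma hasDerivAt_coth_pi_mul {t : ℝ} (ht : t ≠ 0) :
    HasDerivAt (fun y => cosh (π * y) / sinh (π * y))
      (π * (1 - (cosh (π * t) / sinh (π * t)) ^ 2)) t := by
  have hs : sinh (π * t) ≠ 0 := by
    rw [Ne, Real.sinh_eq_zero]; positivity
  have hl : HasDerivAt (fun y => π * y) π t := by simpa using (hasDerivAt_id t).const_mul π
  convert! hl.cosh.div hl.sinh hs using 1
  field_simp

lemma HasDerivAt.eq_of_eqOn_punctured_interval {f g : ℝ → ℝ} {f' g' t : ℝ}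
    (h : ∀ y : ℝ, y ≠ 0 → |y| < 1 → f y = g y) (ht0 : t ≠ 0) (ht : |t| < 1)
    (hf : HasDerivAt f f' t) (hg : HasDerivAt g g' t) : f' = g' := by
  refine hf.unique (hg.congr_of_eventuallyEq ?_)
  filter_upwards [isOpen_ne.mem_nhds ht0,
    (isOpen_lt continuous_abs continuous_const).mem_nhds ht] with y hy0 hy
  exact h y hy0 hy

lemma coth_pi_mul_expansion {t : ℝ} (ht0 : t ≠ 0) (ht : |t| < 1) :
    π * (cosh (π * t) / sinh (π * t)) = 1 / t + ∑' j : ℕ, cothCoeff j * t ^ (2 * j + 1) := by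
  rw [pi_mul_coth_pi_mul ht0, tsum_partial_fractions ht]

lemma coth_pi_mul_expansion_deriv {t : ℝ} (ht0 : t ≠ 0) (ht : |t| < 1) :
    π ^ 2 * (1 - (cosh (π * t) / sinh (π * t)) ^ 2) = -1 / t ^ 2 +
      ∑' j : ℕ, cothCoeff j * (2 * j + 1 : ℕ) * t ^ (2 * j) := by
  have hS := hasDerivAt_tsum_term (c := cothCoeff) (e := fun j => 2 * j + 1)
    abs_cothCoeff_first_le (fun j => by omega) ht
  have hf := (hasDerivAt_coth_pi_mul ht0).const_mul π
  have hg := (hasDerivAt_inv ht0).add hS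
  have := HasDerivAt.eq_of_eqOn_punctured_interval
    (fun y hy0 hy => by simpa using coth_pi_mul_expansion hy0 hy) ht0 ht hf hg
  rw [pow_two π, mul_assoc, this, neg_div, one_div]
  rfl

lemma coth_pi_mul_expansion_deriv_two {t : ℝ} (ht0 : t ≠ 0) (ht : |t| < 1) :
    π ^ 3 * (-2 * (cosh (π * t) / sinh (π * t)) * (1 - (cosh (π * t) / sinh (π * t)) ^ 2)) =
      2 / t ^ 3 +
        ∑' j : ℕ, cothCoeff j * (2 * j + 1 : ℕ) * (2 * j : ℕ) * t ^ (2 * j - 1) := by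
  have hS := hasDerivAt_tsum_term (c := fun j => cothCoeff j * (2 * j + 1 : ℕ))
    (e := fun j => 2 * j)
    (fun j => by
      rw [mul_assoc]
      refine abs_cothCoeff_mul_le (by positivity) ?_
      push_cast
      nlinarith [(Nat.cast_nonneg j : (0 : ℝ) ≤ j), pow_nonneg (Nat.cast_nonneg j : (0 : ℝ) ≤ j) 3,
        pow_nonneg (Nat.cast_nonneg j : (0 : ℝ) ≤ j) 2]) (fun j => by omega) ht
  have hf := (((hasDerivAt_coth_pi_mul ht0).fun_pow 2).const_sub 1).const_mul (π ^ 2)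
  have hg := (((hasDerivAt_pow 2 t).fun_inv (pow_ne_zero 2 ht0)).fun_neg).fun_add hS
  have h := HasDerivAt.eq_of_eqOn_punctured_interval
    (fun y hy0 hy => by simpa [neg_div] using coth_pi_mul_expansion_deriv hy0 hy) ht0 ht hf hg
  convert! h using 1
  · push_cast; ring
  · congr 1
    field_simp
    norm_num

lemma coth_pi_mul_expansion_deriv_three {t : ℝ} (ht0 : t ≠ 0) (ht : |t| < 1) :
    π ^ 4 * (-2 + 8 * (cosh (π * t) / sinh (π * t)) ^ 2 -
        6 * (cosh (π * t) / sinh (π * t)) ^ 4) =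
      -6 / t ^ 4 + ∑' j : ℕ, cothCoeff j * (2 * j + 1 : ℕ) * (2 * j : ℕ) * (2 * j - 1 : ℕ) *
        t ^ (2 * j - 1 - 1) := by
  have hS := hasDerivAt_tsum_term (c := fun j => cothCoeff j * (2 * j + 1 : ℕ) * (2 * j : ℕ))
    (e := fun j => 2 * j - 1)
    abs_cothCoeff_third_le (fun j => by omega) ht
  have hc := hasDerivAt_coth_pi_mul ht0
  have hf := ((hc.const_mul (-2)).fun_mul ((hc.fun_pow 2).const_sub 1)).const_mul (π ^ 3)
  have hg := (((hasDerivAt_pow 3 t).fun_inv (pow_ne_zero 3 ht0)).const_mul 2).fun_add hS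
  have h := HasDerivAt.eq_of_eqOn_punctured_interval
    (fun y hy0 hy => by
      simpa [div_eq_mul_inv] using coth_pi_mul_expansion_deriv_two hy0 hy) ht0 ht hf hg
  convert! h using 1
  · push_cast; ring
  · congr 1
    field_simp
    norm_num

/-- The terms of the expansion of `coth⁴`, as real numbers. -/
noncomputable def cothFourthTerm (t : ℝ) (m : ℕ) : ℝ :=
  (-1) ^ (m + 1) * (2 * (m : ℝ) + 3) *
    ((1 / (6 * π ^ 2)) * (2 * (m : ℝ) + 4) * (2 * (m : ℝ) + 5) * zetaEven (m + 2) -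
      (4 / 3) * zetaEven (m + 1)) * t ^ (2 * m + 2)

lemma hasSum_cothFourthTerm {t : ℝ} (ht0 : t ≠ 0) (ht : |t| < 1) :
    HasSum (cothFourthTerm t) (π ^ 2 / 2 * ((cosh (π * t) / sinh (π * t)) ^ 4 -
      (1 / (π * t) ^ 4 + 4 / (3 * (π * t) ^ 2) + 26 / 45))) := by
  have h1 := (summable_term abs_cothCoeff_first_le (e := fun j => 2 * j)
    (fun j => by omega) ht).hasSum
  have h3 := (summable_term abs_cothCoeff_third_le (e := fun j => 2 * j - 1 - 1)
    (fun j => by omega) ht).hasSum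
  have e1 := coth_pi_mul_expansion_deriv ht0 ht
  have e3 := coth_pi_mul_expansion_deriv_three ht0 ht
  rw [← sub_eq_iff_eq_add'] at e1 e3
  rw [← e1] at h1
  rw [← e3] at h3
  rw [← hasSum_nat_add_iff' 1] at h1
  rw [← hasSum_nat_add_iff' 2] at h3
  have h := ((h3.mul_left (-(1 / (6 * π ^ 4)))).sub (h1.mul_left (4 / (3 * π ^ 2)))).mul_left
    (π ^ 2 / 2)
  have hpi := pi_ne_zero
  convert! h using 1
  · ext m
    have hm' : 2 * (m + 2) - 1 = 2 * m + 3 := by omega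
    simp only [cothFourthTerm, cothCoeff, hm']
    push_cast
    field_simp
    ring
  · simp only [Finset.sum_range_succ, Finset.sum_range_zero, cothCoeff, zetaEven_zero,
      zetaEven_one]
    generalize cosh (π * t) / sinh (π * t) = c
    norm_num
    field_simp
    ring

/-- For real `x` with `0 < |x| < π`,
`coth⁴ x = 1/x⁴ + 4/(3x²) + 26/45 + (2/π²) ∑_{n=1}^∞ (-1)^n (2n+1)
  [(1/(6π²))(2n+2)(2n+3) ζ(2n+4) - (4/3) ζ(2n+2)] (x/π)^(2n)`,
the series converging absolutely (indexed here by `n = m + 1`, `m : ℕ`). -/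
theorem coth_fourth_laurent_series (x : ℝ) (hx0 : 0 < |x|) (hx : |x| < π) :
    Summable (fun m : ℕ => ‖(-1 : ℂ) ^ (m + 1) * (2 * (m : ℂ) + 3) *
      ((1 / (6 * (π : ℂ) ^ 2)) * (2 * (m : ℂ) + 4) * (2 * (m : ℂ) + 5) *
          riemannZeta (2 * (m : ℂ) + 6) -
        (4 / 3) * riemannZeta (2 * (m : ℂ) + 4)) *
      (((x / π) ^ (2 * m + 2) : ℝ) : ℂ)‖) ∧
    (((Real.cosh x / Real.sinh x) ^ 4 : ℝ) : ℂ) =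
      1 / (x : ℂ) ^ 4 + 4 / (3 * (x : ℂ) ^ 2) + 26 / 45 + (2 / (π : ℂ) ^ 2) *
      ∑' m : ℕ, (-1 : ℂ) ^ (m + 1) * (2 * (m : ℂ) + 3) *
        ((1 / (6 * (π : ℂ) ^ 2)) * (2 * (m : ℂ) + 4) * (2 * (m : ℂ) + 5) *
            riemannZeta (2 * (m : ℂ) + 6) -
          (4 / 3) * riemannZeta (2 * (m : ℂ) + 4)) *
        (((x / π) ^ (2 * m + 2) : ℝ) : ℂ) := by
  have hpi := pi_ne_zero
  have hx' : x ≠ 0 := abs_pos.1 hx0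
  have ht : |x / π| < 1 := by rwa [abs_div, abs_of_pos pi_pos, div_lt_one pi_pos]
  have h := hasSum_cothFourthTerm (div_ne_zero hx' hpi) ht
  rw [mul_div_cancel₀ x hpi] at h
  have hterm : ∀ m : ℕ, (-1 : ℂ) ^ (m + 1) * (2 * (m : ℂ) + 3) *
      ((1 / (6 * (π : ℂ) ^ 2)) * (2 * (m : ℂ) + 4) * (2 * (m : ℂ) + 5) *
          riemannZeta (2 * (m : ℂ) + 6) -
        (4 / 3) * riemannZeta (2 * (m : ℂ) + 4)) *
      (((x / π) ^ (2 * m + 2) : ℝ) : ℂ) = (cothFourthTerm (x / π) m : ℂ) := by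
    intro m
    have h1 : 2 * (m : ℂ) + 4 = 2 * ((m + 1 : ℕ) : ℂ) + 2 := by push_cast; ring
    have h2 : 2 * (m : ℂ) + 6 = 2 * ((m + 2 : ℕ) : ℂ) + 2 := by push_cast; ring
    have z1 := riemannZeta_eq_zetaEven (m + 1)
    have z2 := riemannZeta_eq_zetaEven (m + 2)
    rw [← h1] at z1
    rw [← h2] at z2
    rw [z1, z2, cothFourthTerm]
    push_cast
    rfl
  simp_rw [hterm]
  refine ⟨by simpa only [Complex.norm_real] using h.summable.norm, ?_⟩
  rw [← Complex.ofReal_tsum, h.tsum_eq]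
  norm_cast
  generalize cosh x / sinh x = c
  push_cast
  field_simp
  ring
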